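/- Let Ω ⊆ ℝ^d be open and connected, let F satisfy conditions (i) and (ii), and assume F has locally Lipschitz subunit vector fields Z₁,…,Z_m : closure(Ω) → ℝ^d such that the associated control system (S) satisfies the bounded time controllability property (BTC) in Ω. Then any viscosity subsolution u ∈ USC(Ω) of F(x,u,Du,D²u) = 0 achieving a nonnegative maximum in Ω is constant. -/

import Mathlib

open Set Metric Filter Topology

noncomputable section

/-- Euclidean space `ℝ^d`. -/
abbrev EV (d : ℕ) := EuclideanSpace ℝ (Fin d)

/-- The outer product `p ⊗ p` as a `d × d` matrix. -/
def outer {d : ℕ} (p : EV d) : Matrix (Fin d) (Fin d) ℝ := Matrix.of fun i j => p i * p j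

/-- Euclidean dot product. -/
def dotp {d : ℕ} (p q : EV d) : ℝ := ∑ i, p i * q i

/-- Euclidean gradient. -/
def grad {d : ℕ} (φ : EV d → ℝ) (x : EV d) : EV d :=
  (EuclideanSpace.equiv (Fin d) ℝ).symm fun i => fderiv ℝ φ x (EuclideanSpace.single i 1)

/-- Euclidean Hessian matrix. -/
def hess {d : ℕ} (φ : EV d → ℝ) (x : EV d) : Matrix (Fin d) (Fin d) ℝ :=
  Matrix.of fun i j =>
    fderiv ℝ (fun y => fderiv ℝ φ y (EuclideanSpace.single j 1)) x (EuclideanSpace.single i 1)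

/-- `F` is proper: nondecreasing in `r`, nonincreasing in the matrix argument
(w.r.t. the positive semidefinite order `Y ≤ X ↔ (X - Y).PosSemidef`). -/
def IsProper {d m : ℕ} (Ω : Set (EV d))
    (F : EV d → ℝ → EV m → Matrix (Fin m) (Fin m) ℝ → ℝ) : Prop :=
  ∀ x ∈ Ω, ∀ r s : ℝ, ∀ p : EV m, ∀ X Y : Matrix (Fin m) (Fin m) ℝ,
    r ≤ s → (X - Y).PosSemidef → F x r p X ≤ F x s p Y

/-- Lower semicontinuity of the operator `F`, jointly in all its arguments. -/
def IsLscOperator {d m : ℕ} (Ω : Set (EV d))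
    (F : EV d → ℝ → EV m → Matrix (Fin m) (Fin m) ℝ → ℝ) : Prop :=
  LowerSemicontinuousOn
    (fun q : EV d × ℝ × EV m × Matrix (Fin m) (Fin m) ℝ => F q.1 q.2.1 q.2.2.1 q.2.2.2)
    {q | q.1 ∈ Ω ∧ q.2.2.1 ≠ 0 ∧ q.2.2.2.IsSymm}

/-- Condition (ii) (scaling): for some `φ : (0,1] → (0,∞)`,
`F(x, ξs, ξp, ξX) ≥ φ(ξ) F(x,s,p,X)` for all `ξ ∈ (0,1]`, `s ∈ [-1,0]`. -/
def HasScaling {d m : ℕ} (Ω : Set (EV d))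
    (F : EV d → ℝ → EV m → Matrix (Fin m) (Fin m) ℝ → ℝ) : Prop :=
  ∃ φ : ℝ → ℝ, (∀ ξ ∈ Ioc (0:ℝ) 1, 0 < φ ξ) ∧
    ∀ ξ ∈ Ioc (0:ℝ) 1, ∀ s ∈ Icc (-1:ℝ) 0, ∀ x ∈ Ω, ∀ p : EV m, p ≠ 0 →
      ∀ X : Matrix (Fin m) (Fin m) ℝ, X.IsSymm →
        φ ξ * F x s p X ≤ F x (ξ * s) (ξ • p) (ξ • X)

/-- Ellipticity condition (elli) for a subelliptic operator `G`. -/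
def IsElliptic {d m : ℕ} (Ω : Set (EV d))
    (G : EV d → ℝ → EV m → Matrix (Fin m) (Fin m) ℝ → ℝ) : Prop :=
  ∀ x ∈ Ω, ∀ q : EV m, q ≠ 0 → ∀ X : Matrix (Fin m) (Fin m) ℝ, X.IsSymm →
    ∃ γ : ℝ, 0 < γ ∧ 0 < G x 0 q (X - γ • outer q)

/-- `Z` is a generalized subunit vector for `F` at `x`:
`sup_{γ>0} F(x,0,p, I - γ p⊗p) > 0` whenever `Z·p ≠ 0`. -/
def IsSubunitAt {d : ℕ} (F : EV d → ℝ → EV d → Matrix (Fin d) (Fin d) ℝ → ℝ)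
    (x : EV d) (Z : EV d) : Prop :=
  ∀ p : EV d, dotp Z p ≠ 0 → ∃ γ : ℝ, 0 < γ ∧ 0 < F x 0 p (1 - γ • outer p)

/-- Viscosity subsolution (test functions with nonvanishing gradient). -/
def IsViscSubsol {d : ℕ} (Ω : Set (EV d))
    (F : EV d → ℝ → EV d → Matrix (Fin d) (Fin d) ℝ → ℝ) (u : EV d → ℝ) : Prop :=
  ∀ φ : EV d → ℝ, ContDiff ℝ 2 φ → ∀ x ∈ Ω,
    IsLocalMaxOn (fun y => u y - φ y) Ω x → grad φ x ≠ 0 →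
      F x (u x) (grad φ x) (hess φ x) ≤ 0

/-- Viscosity supersolution (test functions with nonvanishing gradient). -/
def IsViscSupersol {d : ℕ} (Ω : Set (EV d))
    (F : EV d → ℝ → EV d → Matrix (Fin d) (Fin d) ℝ → ℝ) (v : EV d → ℝ) : Prop :=
  ∀ φ : EV d → ℝ, ContDiff ℝ 2 φ → ∀ x ∈ Ω,
    IsLocalMinOn (fun y => v y - φ y) Ω x → grad φ x ≠ 0 →
      0 ≤ F x (v x) (grad φ x) (hess φ x)

/-- Viscosity subsolution (all `C²` test functions). -/
def IsViscSubsolAll {d : ℕ} (Ω : Set (EV d))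
    (F : EV d → ℝ → EV d → Matrix (Fin d) (Fin d) ℝ → ℝ) (u : EV d → ℝ) : Prop :=
  ∀ φ : EV d → ℝ, ContDiff ℝ 2 φ → ∀ x ∈ Ω,
    IsLocalMaxOn (fun y => u y - φ y) Ω x →
      F x (u x) (grad φ x) (hess φ x) ≤ 0

/-- Viscosity supersolution (all `C²` test functions). -/
def IsViscSupersolAll {d : ℕ} (Ω : Set (EV d))
    (F : EV d → ℝ → EV d → Matrix (Fin d) (Fin d) ℝ → ℝ) (v : EV d → ℝ) : Prop :=
  ∀ φ : EV d → ℝ, ContDiff ℝ 2 φ → ∀ x ∈ Ω,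
    IsLocalMinOn (fun y => v y - φ y) Ω x →
      0 ≤ F x (v x) (grad φ x) (hess φ x)

/-- Locally Lipschitz on a set. -/
def LocLipschitzOn {α β : Type*} [PseudoMetricSpace α] [PseudoMetricSpace β]
    (f : α → β) (s : Set α) : Prop :=
  ∀ x ∈ s, ∃ K : NNReal, ∃ ε : ℝ, 0 < ε ∧ LipschitzOnWith K f (s ∩ Metric.ball x ε)

/-- Admissible controls: measurable, with `∑ i βᵢ(t)² ≤ 1`. -/
def Admissible {m : ℕ} (β : ℝ → Fin m → ℝ) : Prop :=
  (∀ i, Measurable fun t => β t i) ∧ ∀ t : ℝ, ∑ i, (β t i) ^ 2 ≤ 1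

/-- (Carathéodory) trajectory of the control system `y' = ∑ᵢ βᵢ Zᵢ(y)` on `[0, T]`. -/
def IsTrajOn {d m : ℕ} (Z : Fin m → EV d → EV d) (β : ℝ → Fin m → ℝ)
    (y : ℝ → EV d) (T : ℝ) : Prop :=
  ContinuousOn y (Icc 0 T) ∧
    ∀ t ∈ Icc 0 T, y t = y 0 + ∫ s in (0:ℝ)..t, ∑ i, β s i • Z i (y s)

/-- `x₁` is reachable from `x₀` by the control system, with trajectory staying in `Ω`. -/
def ReachableIn {d m : ℕ} (Ω : Set (EV d)) (Z : Fin m → EV d → EV d)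
    (x₀ x₁ : EV d) : Prop :=
  ∃ (β : ℝ → Fin m → ℝ) (y : ℝ → EV d) (T : ℝ), 0 ≤ T ∧ Admissible β ∧
    IsTrajOn Z β y T ∧ (∀ t ∈ Icc 0 T, y t ∈ Ω) ∧ y 0 = x₀ ∧ y T = x₁

/-- Bounded time controllability in `Ω`. -/
def BTC {d m : ℕ} (Ω : Set (EV d)) (Z : Fin m → EV d → EV d) : Prop :=
  ∀ x₀ ∈ Ω, ∀ x₁ ∈ Ω, ReachableIn Ω Z x₀ x₁

/-- Generalized exterior (Bony, proximal) normal `ν` to `K` at `z`. -/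
def IsExtNormal {d : ℕ} (K : Set (EV d)) (z ν : EV d) : Prop :=
  z ∈ frontier K ∧ ‖ν‖ = 1 ∧
    ∃ t : ℝ, 0 < t ∧ Metric.closedBall (z + t • ν) t ∩ closure K = {z}

/-- Lie bracket of two vector fields. -/
def vfBracket {d : ℕ} (X Y : EV d → EV d) : EV d → EV d :=
  fun x => fderiv ℝ Y x (X x) - fderiv ℝ X x (Y x)

/-- Vector fields obtained from `Z₁,…,Z_m` by iterated Lie brackets. -/
inductive LieGenerated {d m : ℕ} (Z : Fin m → EV d → EV d) : (EV d → EV d) → Prop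
  | base (i : Fin m) : LieGenerated Z (Z i)
  | bracket {X Y : EV d → EV d} :
      LieGenerated Z X → LieGenerated Z Y → LieGenerated Z (vfBracket X Y)

/-- Hörmander condition: the fields and their iterated brackets span `ℝ^d` at every point of `Ω`. -/
def Hormander {d m : ℕ} (Ω : Set (EV d)) (Z : Fin m → EV d → EV d) : Prop :=
  ∀ x ∈ Ω, Submodule.span ℝ {v : EV d | ∃ W, LieGenerated Z W ∧ W x = v} = ⊤

/-- Intrinsic (horizontal) gradient `σ(x)ᵀ p`. -/
def sigmaT {d m : ℕ} (σ : Fin m → EV d → EV d) (x : EV d) (p : EV d) : EV m :=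
  (EuclideanSpace.equiv (Fin m) ℝ).symm fun j => ∑ i, σ j x i * p i

/-- `σ(x)ᵀ X σ(x)` as an `m × m` matrix. -/
def sigmaHess {d m : ℕ} (σ : Fin m → EV d → EV d) (x : EV d)
    (X : Matrix (Fin d) (Fin d) ℝ) : Matrix (Fin m) (Fin m) ℝ :=
  Matrix.of fun j k => ∑ i, ∑ l, σ j x i * X i l * σ k x l

/-- First-order correction term `g(x,p)` of the symmetrized intrinsic Hessian. -/
def corrTerm {d m : ℕ} (σ : Fin m → EV d → EV d) (x : EV d) (p : EV d) :
    Matrix (Fin m) (Fin m) ℝ :=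
  Matrix.of fun j k =>
    ((∑ i, (fderiv ℝ (σ k) x (σ j x)) i * p i) +
      (∑ i, (fderiv ℝ (σ j) x (σ k x)) i * p i)) / 2

/-- Euclidean form `F(x,r,p,X) = G(x, r, σᵀp, σᵀXσ + g(x,p))` of a subelliptic operator. -/
def euclOp {d m : ℕ} (σ : Fin m → EV d → EV d)
    (G : EV d → ℝ → EV m → Matrix (Fin m) (Fin m) ℝ → ℝ) :
    EV d → ℝ → EV d → Matrix (Fin d) (Fin d) ℝ → ℝ :=
  fun x r p X => G x r (sigmaT σ x p) (sigmaHess σ x X + corrTerm σ x p)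

/-- `A ≥ Z ⊗ Z` in the quadratic-form sense: `ξᵀAξ ≥ (Z·ξ)²` for all `ξ`. -/
def matGEouter {d : ℕ} (A : Matrix (Fin d) (Fin d) ℝ) (Z : EV d) : Prop :=
  ∀ ξ : EV d, (dotp Z ξ) ^ 2 ≤ ∑ i, ∑ j, A i j * ξ i * ξ j

/-- The squared distance to `c`, normalised to vanish at `z`. -/
def sqDistGap {d : ℕ} (c z x : EV d) : ℝ := ‖x - c‖ ^ 2 - ‖z - c‖ ^ 2

/-- A smooth barrier, negative in the ball centred at `c` with `z` on its boundary and positive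
just outside it, whose gradient and Hessian at `z` are `p` and `I - γ p ⊗ p` for `p = z - c`. -/
def barrier {d : ℕ} (γ : ℝ) (c z x : EV d) : ℝ :=
  sqDistGap c z x / 2 - γ * sqDistGap c z x ^ 2 / 8

lemma hasFDerivAt_sqDistGap {d : ℕ} (c z x : EV d) :
    HasFDerivAt (sqDistGap c z) (2 • innerSL ℝ (x - c)) x := by
  have h := ((hasFDerivAt_id x).sub_const c).norm_sq.sub_const (‖z - c‖ ^ 2)
  exact h

lemma contDiff_sqDistGap {d : ℕ} (c z : EV d) : ContDiff ℝ 2 (sqDistGap c z) :=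
  ((contDiff_id.sub contDiff_const).norm_sq ℝ).sub contDiff_const

lemma contDiff_barrier {d : ℕ} (γ : ℝ) (c z : EV d) : ContDiff ℝ 2 (barrier γ c z) :=
  ((contDiff_sqDistGap c z).div_const 2).sub
    ((contDiff_const.mul ((contDiff_sqDistGap c z).pow 2)).div_const 8)

lemma fderiv_barrier {d : ℕ} (M ε γ : ℝ) (c z x h : EV d) :
    fderiv ℝ (fun y => M + ε * barrier γ c z y) x h =
      ε * ((1 - γ * sqDistGap c z x / 2) * inner ℝ (x - c) h) := by
  have hw := hasFDerivAt_sqDistGap c z x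
  have hb : HasFDerivAt (fun y => M + ε * barrier γ c z y) _ x :=
    (((hw.mul_const (1 / 2)).sub ((hw.pow 2).const_mul (γ / 8))).const_mul ε).const_add M
      |>.congr_of_eventuallyEq (Eventually.of_forall fun y => by
        simp only [barrier, Pi.sub_apply]; ring)
  rw [hb.fderiv]
  simp only [_root_.smul_apply, _root_.sub_apply, innerSL_apply_apply,
    smul_eq_mul, nsmul_eq_mul]
  ring

lemma grad_barrier {d : ℕ} (M ε γ : ℝ) (c z x : EV d) :
    grad (fun y => M + ε * barrier γ c z y) x =
      ε • ((1 - γ * sqDistGap c z x / 2) • (x - c)) := by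
  ext i
  change fderiv ℝ (fun y => M + ε * barrier γ c z y) x (EuclideanSpace.single i 1) = _
  rw [fderiv_barrier]
  simp [EuclideanSpace.inner_single_right]

lemma hess_barrier {d : ℕ} (M ε γ : ℝ) (c z x : EV d) :
    hess (fun y => M + ε * barrier γ c z y) x =
      ε • ((1 - γ * sqDistGap c z x / 2) • (1 : Matrix (Fin d) (Fin d) ℝ)
        - γ • outer (x - c)) := by
  ext i j
  have hw := hasFDerivAt_sqDistGap c z x
  have hc : HasFDerivAt (fun y : EV d => (y - c) j)
      (EuclideanSpace.proj j : EV d →L[ℝ] ℝ) x :=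
    ((EuclideanSpace.proj j : EV d →L[ℝ] ℝ).hasFDerivAt.sub_const (c j))
  have h1 : HasFDerivAt (fun y => 1 - γ * sqDistGap c z y / 2) _ x :=
    ((hw.const_mul (γ / 2)).const_sub 1).congr_of_eventuallyEq
      (Eventually.of_forall fun y => by ring)
  have h2 : HasFDerivAt (fun y => ε * ((1 - γ * sqDistGap c z y / 2) * (y - c) j)) _ x :=
    (h1.mul hc).const_mul ε
  have h3 : (fun y => fderiv ℝ (fun y => M + ε * barrier γ c z y) y
      (EuclideanSpace.single j 1)) =
      fun y => ε * ((1 - γ * sqDistGap c z y / 2) * (y - c) j) := by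
    ext y
    rw [fderiv_barrier]
    simp [EuclideanSpace.inner_single_right]
  simp only [hess, Matrix.of_apply]
  rw [h3, h2.fderiv]
  simp [outer, Matrix.one_apply, EuclideanSpace.inner_single_right, eq_comm]
  split_ifs <;> ring

lemma continuous_sqDistGap {d : ℕ} (c z : EV d) : Continuous (sqDistGap c z) :=
  (contDiff_sqDistGap c z).continuous

lemma continuous_barrier {d : ℕ} (γ : ℝ) (c z : EV d) : Continuous (barrier γ c z) :=
  (contDiff_barrier γ c z).continuous

lemma continuous_outer {d : ℕ} : Continuous (outer : EV d → Matrix (Fin d) (Fin d) ℝ) := by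
  unfold outer
  fun_prop

lemma isSymm_outer {d : ℕ} (p : EV d) : (outer p).IsSymm := by
  ext i j
  simp [outer, mul_comm]

lemma exists_le_sub_of_upperSemicontinuousOn {α : Type*} [TopologicalSpace α] {f : α → ℝ}
    {s : Set α} (hs : IsCompact s) (hf : UpperSemicontinuousOn f s) {M : ℝ}
    (hM : ∀ x ∈ s, f x < M) : ∃ δ > 0, ∀ x ∈ s, f x ≤ M - δ := by
  rcases s.eq_empty_or_nonempty with rfl | hne
  · exact ⟨1, one_pos, by simp⟩
  · obtain ⟨a, ha, hmax⟩ := hf.exists_isMaxOn hne hs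
    refine ⟨M - f a, sub_pos.2 (hM a ha), fun x hx => ?_⟩
    have : f x ≤ f a := hmax hx
    linarith

/-- The Hopf-type step: a subunit vector is orthogonal to every proximal normal of the set where a
subsolution attains a nonnegative maximum. -/
lemma dotp_eq_zero_of_touching {d : ℕ} {Ω : Set (EV d)} (hΩ : IsOpen Ω)
    {F : EV d → ℝ → EV d → Matrix (Fin d) (Fin d) ℝ → ℝ}
    (hFlsc : IsLscOperator Ω F) (hFprop : IsProper Ω F) (hFscal : HasScaling Ω F)
    {u : EV d → ℝ} (husc : UpperSemicontinuousOn u Ω) (hsub : IsViscSubsol Ω F u)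
    {z c V : EV d} (hz : z ∈ Ω) (hV : IsSubunitAt F z V) (hmax : ∀ x ∈ Ω, u x ≤ u z)
    (hnn : 0 ≤ u z) (htouch : ∀ x ∈ Ω, ‖x - c‖ ≤ ‖z - c‖ → x ≠ z → u x < u z) :
    dotp V (z - c) = 0 := by
  by_contra hne
  obtain ⟨γ, hγ, hFpos⟩ := hV _ hne
  obtain ⟨φ, hφ, hscal⟩ := hFscal
  have hp : z - c ≠ 0 := by
    rintro h
    simp [h, dotp] at hne
  set P : EV d → EV d := fun x => (1 - γ * sqDistGap c z x / 2) • (x - c) with hP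
  set H : EV d → Matrix (Fin d) (Fin d) ℝ := fun x =>
    (1 - γ * sqDistGap c z x / 2) • (1 : Matrix (Fin d) (Fin d) ℝ) - γ • outer (x - c) with hH
  have hw := continuous_sqDistGap c z
  have hv := continuous_barrier γ c z
  have hwz : sqDistGap c z z = 0 := by simp [sqDistGap]
  have hvz : barrier γ c z z = 0 := by simp [barrier, hwz]
  have hPz : P z = z - c := by simp [hP, hwz]
  have hHz : H z = 1 - γ • outer (z - c) := by simp [hH, hwz]
  have hPc : Continuous P := by fun_prop
  have hHc : Continuous H := by
    have h1 : Continuous fun x => outer (x - c) := continuous_outer.comp (by fun_prop)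
    fun_prop
  have hHs : ∀ x, (H x).IsSymm := fun x =>
    ((Matrix.isSymm_one).smul _).sub ((isSymm_outer _).smul _)
  have hPne : ∀ᶠ x in 𝓝 z, P x ≠ 0 :=
    hPc.continuousAt.eventually_ne (by rwa [hPz])
  have hFev : ∀ᶠ x in 𝓝 z, 0 < F x (barrier γ c z x) (P x) (H x) := by
    have hq := hFlsc (z, barrier γ c z z, P z, H z) ⟨hz, by simpa [hPz] using hp, hHs z⟩ 0
      (by simpa only [hvz, hPz, hHz] using hFpos)
    have ht : Tendsto (fun x => (x, barrier γ c z x, P x, H x)) (𝓝 z)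
        (𝓝[{q | q.1 ∈ Ω ∧ q.2.2.1 ≠ 0 ∧ q.2.2.2.IsSymm}] (z, barrier γ c z z, P z, H z)) := by
      refine tendsto_nhdsWithin_iff.2 ⟨Continuous.tendsto (by fun_prop) z, ?_⟩
      filter_upwards [hΩ.mem_nhds hz, hPne] with x hx hx'
      exact ⟨hx, hx', hHs x⟩
    exact ht.eventually hq
  have hvev : ∀ᶠ x in 𝓝 z, -1 < barrier γ c z x :=
    hv.continuousAt.eventually_const_lt (by rw [hvz]; norm_num)
  have hwev : ∀ᶠ x in 𝓝 z, γ * sqDistGap c z x < 4 :=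
    ContinuousAt.tendsto (f := fun x => γ * sqDistGap c z x) (by fun_prop)
      |>.eventually_lt_const (by simp [hwz])
  obtain ⟨r, hr, hball⟩ := Metric.nhds_basis_closedBall.eventually_iff.1
    ((hΩ.eventually_mem hz).and (hPne.and (hFev.and (hvev.and hwev))))
  have hsubΩ : closedBall z r ⊆ Ω := fun x hx => (hball hx).1
  obtain ⟨δ, hδ, huδ⟩ : ∃ δ > 0, ∀ x ∈ sphere z r ∩ {x | sqDistGap c z x ≤ 0},
      u x ≤ u z - δ := by
    refine exists_le_sub_of_upperSemicontinuousOn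
      ((isCompact_sphere z r).inter_right (isClosed_le hw continuous_const))
      (husc.mono fun x hx => hsubΩ (sphere_subset_closedBall hx.1)) fun x hx => ?_
    refine htouch x (hsubΩ (sphere_subset_closedBall hx.1)) ?_ ?_
    · have h2 : ‖x - c‖ ^ 2 - ‖z - c‖ ^ 2 ≤ 0 := hx.2
      exact le_of_sq_le_sq (by linarith) (norm_nonneg _)
    · rintro rfl
      simp [hr.ne] at hx
  set ε := min (δ / 2) 1 with hε
  have hε0 : 0 < ε := lt_min (by linarith) one_pos
  have hεδ : ε ≤ δ / 2 := min_le_left _ _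
  have hε1 : ε ≤ 1 := min_le_right _ _
  set ψ : EV d → ℝ := fun y => u z + ε * barrier γ c z y with hψ
  have hψC : ContDiff ℝ 2 ψ := contDiff_const.add (contDiff_const.mul (contDiff_barrier γ c z))
  have hfac : ∀ x, barrier γ c z x = sqDistGap c z x / 2 * (1 - γ * sqDistGap c z x / 4) :=
    fun x => by simp only [barrier]; ring
  have hout : ∀ x ∈ closedBall z r, 0 < sqDistGap c z x → u x - ψ x < 0 := by
    intro x hx hwx
    have h1 := (hball hx).2.2.2.2
    have h2 : 0 < barrier γ c z x := by
      rw [hfac]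
      exact mul_pos (by linarith) (by linarith)
    have h3 := hmax x (hsubΩ hx)
    have h4 := mul_pos hε0 h2
    simp only [hψ]
    linarith
  have husc' : UpperSemicontinuousOn (fun y => u y + -ψ y) (closedBall z r) :=
    (husc.mono hsubΩ).add (hψC.continuous.neg.continuousOn.upperSemicontinuousOn)
  obtain ⟨x, hx, hxmax⟩ := husc'.exists_isMaxOn ⟨z, mem_closedBall_self hr.le⟩
    (isCompact_closedBall z r)
  have hxmax' : ∀ y ∈ closedBall z r, u y - ψ y ≤ u x - ψ x := fun y hy => by
    have := hxmax hy
    simpa [sub_eq_add_neg] using this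
  have hx0 : 0 ≤ u x - ψ x := by
    have := hxmax' z (mem_closedBall_self hr.le)
    simpa [hψ, hvz] using this
  obtain ⟨hxΩ, hxP, hxF, hxv, -⟩ := hball hx
  have hwx : sqDistGap c z x ≤ 0 := not_lt.1 fun h => absurd (hout x hx h) (not_lt.2 hx0)
  have hvx : barrier γ c z x ≤ 0 := by
    simp only [barrier]
    nlinarith [sq_nonneg (sqDistGap c z x)]
  have hxball : x ∈ ball z r := by
    refine lt_of_le_of_ne (mem_closedBall.1 hx) fun h => ?_
    have h1 := huδ x ⟨h, hwx⟩
    simp only [hψ] at hx0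
    nlinarith
  have hloc : IsLocalMaxOn (fun y => u y - ψ y) Ω x := by
    filter_upwards [mem_nhdsWithin_of_mem_nhds (isOpen_ball.mem_nhds hxball)] with y hy
    exact hxmax' y (ball_subset_closedBall hy)
  have hg : grad ψ x = ε • P x := grad_barrier _ _ _ _ _ _
  have hh : hess ψ x = ε • H x := hess_barrier _ _ _ _ _ _
  have hle := hsub ψ hψC x hxΩ hloc (by rw [hg]; exact smul_ne_zero hε0.ne' hxP)
  rw [hg, hh] at hle
  have h1 := hscal ε ⟨hε0, hε1⟩ _ ⟨hxv.le, hvx⟩ x hxΩ (P x) hxP (H x) (hHs x)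
  have h2 := hFprop x hxΩ (ε * barrier γ c z x) (u x) (ε • P x) (ε • H x) (ε • H x)
    (by simp only [hψ] at hx0; linarith) (by rw [sub_self]; exact Matrix.PosSemidef.zero)
  have h3 := mul_pos (hφ ε ⟨hε0, hε1⟩) hxF
  linarith

/-- An absolutely continuous curve whose velocity is, up to a Lipschitz error, orthogonal to the
proximal normals of a compact set `K` cannot leave `K`. -/
lemma mem_of_orthogonal_to_proximal_normals {E : Type*} [NormedAddCommGroup E]
    [InnerProductSpace ℝ E] [CompleteSpace E] {K : Set E} (hK : IsCompact K) {y f : ℝ → E}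
    {a b C L : ℝ} (hy : ContinuousOn y (Icc a b)) (ha : y a ∈ K)
    (hf : MeasureTheory.IntegrableOn f (Icc a b))
    (hyf : ∀ t ∈ Icc a b, ∀ s ∈ Icc a b, y s - y t = ∫ τ in t..s, f τ)
    (hC0 : 0 ≤ C) (hC : ∀ t ∈ Icc a b, ‖f t‖ ≤ C) (hL0 : 0 ≤ L)
    (hL : ∀ t ∈ Icc a b, ∀ τ ∈ Icc a b, ∀ k ∈ K, infDist (y t) K = dist (y t) k →
      |inner ℝ (y t - k) (f τ)| ≤ L * (‖y τ - k‖ * ‖y t - k‖)) :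
    ∀ t ∈ Icc a b, y t ∈ K := by
  have hKne : K.Nonempty := ⟨_, ha⟩
  have hsub : ∀ t ∈ Icc a b, ∀ s ∈ Icc a b, uIoc t s ⊆ Icc a b := fun t ht s hs =>
    uIoc_subset_uIcc.trans (uIcc_subset_Icc ht hs)
  have hlip : ∀ t ∈ Icc a b, ∀ s ∈ Icc a b, ‖y s - y t‖ ≤ C * |s - t| := fun t ht s hs => by
    rw [hyf t ht s hs]
    exact intervalIntegral.norm_integral_le_of_norm_le_const fun τ hτ => hC τ (hsub t ht s hs hτ)
  have hgrowth : ∀ t ∈ Icc a b, ∀ s ∈ Icc a b, t < s →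
      infDist (y s) K ^ 2 - infDist (y t) K ^ 2 ≤ (s - t) * (2 * L * infDist (y t) K ^ 2
        + (s - t) * (2 * L * C * infDist (y t) K + C ^ 2)) := by
    intro t ht s hs hts
    obtain ⟨k, hk, hkd⟩ := hK.exists_infDist_eq_dist hKne (y t)
    have hq : infDist (y t) K = ‖y t - k‖ := by rw [hkd, dist_eq_norm]
    have habs : |s - t| = s - t := abs_of_pos (sub_pos.2 hts)
    have hint : IntervalIntegrable f MeasureTheory.volume t s :=
      (hf.mono_set (uIcc_subset_Icc ht hs)).intervalIntegrable
    have hinner : inner ℝ (y t - k) (y s - y t) ≤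
        L * ((C * (s - t) + ‖y t - k‖) * ‖y t - k‖) * (s - t) := by
      have h1 : inner ℝ (y t - k) (y s - y t) = ∫ τ in t..s, inner ℝ (y t - k) (f τ) := by
        rw [hyf t ht s hs]
        exact ((innerSL ℝ (y t - k)).intervalIntegral_comp_comm hint).symm
      rw [h1]
      refine (le_abs_self _).trans ?_
      rw [← Real.norm_eq_abs]
      refine (intervalIntegral.norm_integral_le_of_norm_le_const
        (C := L * ((C * (s - t) + ‖y t - k‖) * ‖y t - k‖)) fun τ hτ => ?_).trans (by rw [habs])
      rw [Real.norm_eq_abs]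
      have hτ' := hsub t ht s hs hτ
      refine (hL t ht τ hτ' k hk hkd).trans ?_
      rw [uIoc_of_le hts.le] at hτ
      have h2 : ‖y τ - k‖ ≤ C * (s - t) + ‖y t - k‖ := by
        have h3 := hlip t ht τ hτ'
        rw [abs_of_pos (sub_pos.2 hτ.1)] at h3
        have h4 : C * (τ - t) ≤ C * (s - t) :=
          mul_le_mul_of_nonneg_left (by linarith [hτ.2]) hC0
        have h5 := norm_sub_le_norm_sub_add_norm_sub (y τ) (y t) k
        linarith
      gcongr
    have h6 : infDist (y s) K ≤ ‖y s - k‖ := by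
      rw [← dist_eq_norm]
      exact infDist_le_dist_of_mem hk
    have h7 : infDist (y s) K ^ 2 ≤ ‖y s - k‖ ^ 2 := by
      gcongr
      exact infDist_nonneg
    have h8 : ‖y s - k‖ ^ 2 =
        ‖y t - k‖ ^ 2 + 2 * inner ℝ (y t - k) (y s - y t) + ‖y s - y t‖ ^ 2 := by
      rw [← norm_add_sq_real]
      congr 2
      abel
    have h9 : ‖y s - y t‖ ^ 2 ≤ (C * (s - t)) ^ 2 := by
      have := hlip t ht s hs
      rw [habs] at this
      gcongr
    rw [hq]
    linarith
  have hzero := le_gronwallBound_of_liminf_deriv_right_le (f := fun t => infDist (y t) K ^ 2)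
    (f' := fun t => 2 * L * infDist (y t) K ^ 2) (δ := 0) (K := 2 * L) (ε := 0) (a := a) (b := b)
    (((continuous_infDist_pt K).comp_continuousOn hy).pow 2)
    (fun t ht r hr => by
      have htend : Tendsto (fun s => 2 * L * infDist (y t) K ^ 2
          + (s - t) * (2 * L * C * infDist (y t) K + C ^ 2)) (𝓝[>] t)
          (𝓝 (2 * L * infDist (y t) K ^ 2)) := by
        refine Tendsto.mono_left ?_ nhdsWithin_le_nhds
        refine Continuous.tendsto' (by fun_prop) _ _ (by simp)
      have hev : ∀ᶠ s in 𝓝[>] t, s ∈ Ioc t b := Ioc_mem_nhdsGT ht.2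
      refine Eventually.frequently ?_
      filter_upwards [htend.eventually_lt_const hr, hev] with s hs hsb
      refine lt_of_le_of_lt ?_ hs
      rw [inv_mul_le_iff₀ (sub_pos.2 hsb.1)]
      exact hgrowth t ⟨ht.1, ht.2.le⟩ s ⟨ht.1.trans hsb.1.le, hsb.2⟩ hsb.1)
    (by simp [infDist_zero_of_mem ha]) (fun t _ => by simp)
  intro t ht
  have h := hzero t ht
  rw [gronwallBound_ε0_δ0] at h
  have h0 : infDist (y t) K = 0 := pow_eq_zero_iff two_ne_zero |>.1 (le_antisymm h (sq_nonneg _))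
  exact (hK.isClosed.mem_iff_infDist_zero hKne).2 h0

lemma dotp_eq_inner {d : ℕ} (V q : EV d) : dotp V q = inner ℝ q V := by
  simp [dotp, PiLp.inner_apply]

lemma Admissible.abs_le_one {m : ℕ} {β : ℝ → Fin m → ℝ} (hβ : Admissible β) (t : ℝ) (i : Fin m) :
    |β t i| ≤ 1 := by
  rw [← sq_le_one_iff_abs_le_one]
  exact (Finset.single_le_sum (f := fun i => β t i ^ 2) (fun j _ => sq_nonneg _)
    (Finset.mem_univ i)).trans (hβ.2 t)

lemma LocLipschitzOn.continuousOn {α β : Type*} [PseudoMetricSpace α] [PseudoMetricSpace β]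
    {f : α → β} {s : Set α} (hf : LocLipschitzOn f s) : ContinuousOn f s := by
  intro x hx
  obtain ⟨K, ε, hε, h⟩ := hf x hx
  exact (h.continuousOn x ⟨hx, mem_ball_self hε⟩).mono_of_mem_nhdsWithin
    (inter_mem_nhdsWithin s (ball_mem_nhds x hε))

lemma Admissible.integrableOn_velocity {d m : ℕ} {Z : Fin m → EV d → EV d} {β : ℝ → Fin m → ℝ}
    (hβ : Admissible β) {y : ℝ → EV d} {T : ℝ}
    (hZy : ∀ i, ContinuousOn (fun t => Z i (y t)) (Icc 0 T)) :
    MeasureTheory.IntegrableOn (fun s => ∑ i, β s i • Z i (y s)) (Icc 0 T) := by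
  refine MeasureTheory.integrable_finsetSum _ fun i _ => ?_
  exact MeasureTheory.Integrable.bdd_smul (hZy i).integrableOn_Icc 1
    (hβ.1 i).aestronglyMeasurable (Eventually.of_forall fun t => hβ.abs_le_one t i)

lemma exists_closedBall_lipschitz {d m : ℕ} {Ω : Set (EV d)} (hΩ : IsOpen Ω)
    {Z : Fin m → EV d → EV d} (hZ : ∀ i, LocLipschitzOn (Z i) (closure Ω)) {p : EV d}
    (hp : p ∈ Ω) : ∃ R > 0, ∃ L ≥ 0, closedBall p R ⊆ Ω ∧
      ∀ i, ∀ x ∈ closedBall p R, ∀ x' ∈ closedBall p R, ‖Z i x - Z i x'‖ ≤ L * ‖x - x'‖ := by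
  choose κ ε hε hlip using fun i => hZ i p (subset_closure hp)
  have hev : ∀ᶠ x in 𝓝 p, x ∈ Ω ∧ ∀ i, x ∈ ball p (ε i) :=
    (hΩ.eventually_mem hp).and (eventually_all.2 fun i => ball_mem_nhds p (hε i))
  obtain ⟨R, hR, hball⟩ := Metric.nhds_basis_closedBall.eventually_iff.1 hev
  refine ⟨R, hR, ∑ i, (κ i : ℝ), Finset.sum_nonneg fun i _ => (κ i).2, fun x hx => (hball hx).1,
    fun i x hx x' hx' => ?_⟩
  have h := (hlip i).dist_le_mul x ⟨subset_closure (hball hx).1, (hball hx).2 i⟩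
    x' ⟨subset_closure (hball hx').1, (hball hx').2 i⟩
  rw [dist_eq_norm, dist_eq_norm] at h
  refine h.trans (mul_le_mul_of_nonneg_right ?_ (norm_nonneg _))
  exact Finset.single_le_sum (f := fun i => (κ i : ℝ)) (fun j _ => (κ j).2) (Finset.mem_univ i)

/-- Every point other than `k` of the ball with diameter `[q, k]` is closer to `q` than `k` is. -/
lemma norm_sub_lt_of_norm_sub_midpoint_le {E : Type*} [NormedAddCommGroup E]
    [InnerProductSpace ℝ E] {q k x : E}
    (h : ‖x - midpoint ℝ q k‖ ≤ ‖k - midpoint ℝ q k‖) (hne : x ≠ k) : ‖q - x‖ < ‖q - k‖ := by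
  set c := midpoint ℝ q k with hc
  have hqc : q - c = -(k - c) := by
    rw [hc, midpoint_eq_smul_add, invOf_eq_inv]
    module
  have h1 := parallelogram_law_with_norm ℝ (x - c) (k - c)
  have h2 : x - c + (k - c) = -(q - x) := by
    rw [show k - c = -(q - c) by rw [hqc, neg_neg]]
    abel
  have h3 : x - c - (k - c) = x - k := by abel
  have h4 : ‖q - k‖ = 2 * ‖k - c‖ := by
    rw [show q - k = -((2 : ℝ) • (k - c)) by
      rw [two_smul, ← sub_sub_sub_cancel_right q k c, hqc]; abel]
    rw [norm_neg, norm_smul]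
    simp
  rw [h2, h3, norm_neg] at h1
  have h5 : 0 < ‖x - k‖ := norm_pos_iff.2 (sub_ne_zero.2 hne)
  refine lt_of_pow_lt_pow_left₀ 2 (norm_nonneg _) ?_
  rw [h4]
  nlinarith [norm_nonneg (x - c)]

/-- The set where the subsolution attains its maximum cannot be left in a short time. -/
lemma exists_Icc_eq_max {d m : ℕ} {Ω : Set (EV d)} (hΩ : IsOpen Ω)
    {F : EV d → ℝ → EV d → Matrix (Fin d) (Fin d) ℝ → ℝ}
    (hFlsc : IsLscOperator Ω F) (hFprop : IsProper Ω F) (hFscal : HasScaling Ω F)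
    {Z : Fin m → EV d → EV d} (hZlip : ∀ i, LocLipschitzOn (Z i) (closure Ω))
    (hZsv : ∀ i, ∀ x ∈ Ω, IsSubunitAt F x (Z i x))
    {u : EV d → ℝ} (husc : UpperSemicontinuousOn u Ω) (hsub : IsViscSubsol Ω F u)
    {M : ℝ} (hmax : ∀ x ∈ Ω, u x ≤ M) (hnn : 0 ≤ M)
    {β : ℝ → Fin m → ℝ} {y : ℝ → EV d} {T : ℝ} (hβ : Admissible β) (hy : IsTrajOn Z β y T)
    (hyΩ : ∀ t ∈ Icc 0 T, y t ∈ Ω) {t₀ : ℝ} (ht₀ : t₀ ∈ Ico 0 T) (hM : u (y t₀) = M) :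
    ∃ b ∈ Ioc t₀ T, ∀ t ∈ Icc t₀ b, u (y t) = M := by
  obtain ⟨hyc, hyint⟩ := hy
  have ht₀' : t₀ ∈ Icc 0 T := ⟨ht₀.1, ht₀.2.le⟩
  obtain ⟨R, hR, L, hL0, hRΩ, hL⟩ := exists_closedBall_lipschitz hΩ hZlip (hyΩ t₀ ht₀')
  have hnear : ∀ᶠ t in 𝓝[Icc 0 T] t₀, y t ∈ closedBall (y t₀) (R / 3) :=
    hyc t₀ ht₀' (closedBall_mem_nhds _ (by positivity))
  obtain ⟨δ, hδ, hδy⟩ := Metric.mem_nhdsWithin_iff.1 hnear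
  set b := min T (t₀ + δ / 2) with hb
  have hbT : b ≤ T := min_le_left _ _
  have htb : t₀ < b := lt_min ht₀.2 (by linarith)
  have hIcc : Icc t₀ b ⊆ Icc 0 T := Icc_subset_Icc ht₀.1 hbT
  have hyR : ∀ t ∈ Icc t₀ b, y t ∈ closedBall (y t₀) (R / 3) := fun t ht => by
    refine hδy ⟨?_, hIcc ht⟩
    have := ht.2.trans (min_le_right _ _)
    rw [mem_ball, Real.dist_eq, abs_of_nonneg (by linarith [ht.1])]
    linarith
  have hZy : ∀ i, ContinuousOn (fun t => Z i (y t)) (Icc 0 T) := fun i =>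
    (hZlip i).continuousOn.comp hyc fun t ht => subset_closure (hyΩ t ht)
  have hf := hβ.integrableOn_velocity hZy
  have hyf : ∀ t ∈ Icc 0 T, ∀ s ∈ Icc 0 T,
      y s - y t = ∫ τ in t..s, ∑ i, β τ i • Z i (y τ) := by
    intro t ht s hs
    have hI : ∀ a ∈ Icc 0 T, IntervalIntegrable (fun τ => ∑ i, β τ i • Z i (y τ))
        MeasureTheory.volume 0 a := fun a ha =>
      (hf.mono_set (uIcc_subset_Icc ⟨le_rfl, ha.1.trans ha.2⟩ ha)).intervalIntegrable
    rw [hyint s hs, hyint t ht, add_sub_add_left_eq_sub]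
    exact intervalIntegral.integral_interval_sub_left (hI s hs) (hI t ht)
  obtain ⟨C, hC⟩ := isCompact_Icc.exists_bound_of_continuousOn
    (continuousOn_finsetSum Finset.univ fun i _ => (hZy i).norm)
  have hC' : ∀ t ∈ Icc 0 T, ‖∑ i, β t i • Z i (y t)‖ ≤ C := fun t ht => by
    refine le_trans ?_ ((le_abs_self _).trans (hC t ht))
    refine norm_sum_le_of_le _ fun i _ => ?_
    rw [norm_smul]
    exact mul_le_of_le_one_left (norm_nonneg _) (hβ.abs_le_one t i)
  set K := closedBall (y t₀) R ∩ u ⁻¹' Ici M with hK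
  have hKc : IsCompact K :=
    (husc.mono hRΩ).isCompact_inter_preimage_Ici (isCompact_closedBall _ _) M
  have hKM : ∀ x ∈ K, u x = M := fun x hx => le_antisymm (hmax x (hRΩ hx.1)) hx.2
  have h₀K : y t₀ ∈ K := ⟨mem_closedBall_self hR.le, hM.ge⟩
  have horth : ∀ t ∈ Icc t₀ b, ∀ k ∈ K, infDist (y t) K = dist (y t) k → ∀ i,
      inner ℝ (y t - k) (Z i k) = 0 := by
    intro t ht k hk hkd i
    have hkΩ := hRΩ hk.1
    have htouch : ∀ x ∈ Ω, ‖x - midpoint ℝ (y t) k‖ ≤ ‖k - midpoint ℝ (y t) k‖ → x ≠ k →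
        u x < u k := by
      intro x hx hxk hne
      have h1 := norm_sub_lt_of_norm_sub_midpoint_le hxk hne
      rw [← dist_eq_norm, ← dist_eq_norm, ← hkd] at h1
      rw [hKM k hk]
      refine not_le.1 fun hux => (infDist_le_dist_of_mem (s := K) ⟨?_, hux⟩).not_gt h1
      have h2 := hyR t ht
      have h3 := infDist_le_dist_of_mem (x := y t) h₀K
      rw [mem_closedBall] at h2 ⊢
      have h4 := dist_triangle_left x (y t₀) (y t)
      linarith
    have h := dotp_eq_zero_of_touching hΩ hFlsc hFprop hFscal husc hsub hkΩ (hZsv i k hkΩ)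
      (fun x hx => (hmax x hx).trans (hKM k hk).ge) (hnn.trans (hKM k hk).ge) htouch
    have hmid : k - midpoint ℝ (y t) k = (-(1 / 2) : ℝ) • (y t - k) := by
      rw [midpoint_eq_smul_add, invOf_eq_inv]
      module
    rw [dotp_eq_inner, hmid, real_inner_smul_left] at h
    exact (mul_eq_zero.1 h).resolve_left (by norm_num)
  refine ⟨b, ⟨htb, hbT⟩, fun t ht => hKM _ ?_⟩
  refine mem_of_orthogonal_to_proximal_normals hKc (L := m * L) (hyc.mono hIcc) h₀K
    (hf.mono_set hIcc) (fun t ht s hs => hyf t (hIcc ht) s (hIcc hs))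
    ((norm_nonneg _).trans (hC' t₀ ht₀')) (fun t ht => hC' t (hIcc ht)) (by positivity) ?_ t ht
  intro t ht τ hτ k hk hkd
  have hyτ : y τ ∈ closedBall (y t₀) R := closedBall_subset_closedBall (by linarith) (hyR τ hτ)
  have hsum : inner ℝ (y t - k) (∑ i, β τ i • Z i (y τ)) =
      ∑ i, β τ i * inner ℝ (y t - k) (Z i (y τ) - Z i k) := by
    simp only [inner_sum, real_inner_smul_right, inner_sub_right, horth t ht k hk hkd, sub_zero]
  rw [hsum]
  calc |∑ i, β τ i * inner ℝ (y t - k) (Z i (y τ) - Z i k)|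
      ≤ ∑ i, |β τ i * inner ℝ (y t - k) (Z i (y τ) - Z i k)| := Finset.abs_sum_le_sum_abs _ _
    _ ≤ ∑ _i : Fin m, L * (‖y τ - k‖ * ‖y t - k‖) := by
        refine Finset.sum_le_sum fun i _ => ?_
        rw [abs_mul]
        refine (mul_le_of_le_one_left (abs_nonneg _) (hβ.abs_le_one τ i)).trans ?_
        refine (abs_real_inner_le_norm _ _).trans ?_
        have := mul_le_mul_of_nonneg_left (hL i (y τ) hyτ k hk.1) (norm_nonneg (y t - k))
        linarith
    _ = m * L * (‖y τ - k‖ * ‖y t - k‖) := by simp; ring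

/-- Corollary 2.6, Strong Maximum Principle under (BTC): if the control
system of the subunit vector fields is boundedly-time controllable in `Ω`, then any viscosity
subsolution achieving a nonnegative maximum in `Ω` is constant. -/
theorem strong_maximum_principle_BTC {d m : ℕ} (Ω : Set (EV d))
    (hΩ : IsOpen Ω) (hconn : IsConnected Ω)
    (F : EV d → ℝ → EV d → Matrix (Fin d) (Fin d) ℝ → ℝ)
    (hFlsc : IsLscOperator Ω F) (hFprop : IsProper Ω F) (hFscal : HasScaling Ω F)
    (Z : Fin m → EV d → EV d) (hZlip : ∀ i, LocLipschitzOn (Z i) (closure Ω))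
    (hZsv : ∀ i, ∀ x ∈ Ω, IsSubunitAt F x (Z i x))
    (hBTC : BTC Ω Z)
    (u : EV d → ℝ) (husc : UpperSemicontinuousOn u Ω)
    (hsub : IsViscSubsol Ω F u)
    (x₀ : EV d) (hx₀ : x₀ ∈ Ω) (hmax : ∀ x ∈ Ω, u x ≤ u x₀) (hnn : 0 ≤ u x₀) :
    ∀ x ∈ Ω, u x = u x₀ := by
  intro x hx
  obtain ⟨β, y, T, hT, hβ, hy, hyΩ, hy0, hyT⟩ := hBTC x₀ hx₀ x hx
  have hcl : IsClosed ({t | u (y t) = u x₀} ∩ Icc 0 T) := by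
    have huy : UpperSemicontinuousOn (fun t => u (y t)) (Icc 0 T) :=
      husc.comp hy.1 fun t ht => hyΩ t ht
    convert (huy.isCompact_inter_preimage_Ici isCompact_Icc (u x₀)).isClosed using 1
    ext t
    refine ⟨fun h => ⟨h.2, h.1.ge⟩, fun h => ⟨le_antisymm (hmax _ (hyΩ t h.1)) h.2, h.1⟩⟩
  have hall := hcl.Icc_subset_of_forall_exists_gt (by simp [hy0]) fun t ht s hs => by
    obtain ⟨b, hb, hbu⟩ := exists_Icc_eq_max hΩ hFlsc hFprop hFscal hZlip hZsv husc hsub hmax hnn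
      hβ hy hyΩ ht.2 ht.1
    exact ⟨min s b, hbu _ ⟨(lt_min hs hb.1).le, min_le_right _ _⟩, lt_min hs hb.1, min_le_left _ _⟩
  rw [← hyT]
  exact hall (right_mem_Icc.2 hT)
end
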